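/- For a bias parameter τ̃ ≥ 0 define the modified selection indicator S̃_{τ̃} := 1(μ(X, R, U) ≥ c + τ̃·R), under which discrimination yields fewer labels for the group R = 1. Fix x ∈ 𝒳 and τ̃₁ ≤ τ̃₂ with ℙ(X = x, R = 1, S̃_{τ̃₂} = 1) > 0. Then E[Y | X = x, R = 1, S̃_{τ̃₁} = 1] ≤ E[Y | X = x, R = 1, S̃_{τ̃₂} = 1] (the predictor for R = 1 is weakly increasing in τ̃), while for any τ̃₁, τ̃₂ with ℙ(X = x, R = 0, S̃_{τ̃₁} = 1) > 0, E[Y | X = x, R = 0, S̃_{τ̃₁} = 1] = E[Y | X = x, R = 0, S̃_{τ̃₂} = 1] (Corollary 3, pointwise part). -/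

import Mathlib

open MeasureTheory

/-- Conditional expectation given an event: `E[Z | A] = (∫_A Z dP) / P(A)`. -/
noncomputable def condE {Ω : Type*} [MeasurableSpace Ω] (P : Measure Ω)
    (Z : Ω → ℝ) (A : Set Ω) : ℝ :=
  (∫ ω in A, Z ω ∂P) / (P A).toReal

theorem condE_mul_toReal {Ω : Type*} [MeasurableSpace Ω] (P : Measure Ω)
    [IsFiniteMeasure P] (Z : Ω → ℝ) (A : Set Ω) :
    condE P Z A * (P A).toReal = ∫ ω in A, Z ω ∂P := by
  unfold condE
  by_cases h : P A = 0
  · simp [h, Measure.restrict_eq_zero.mpr h]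
  · exact div_mul_cancel₀ _ (ENNReal.toReal_ne_zero.mpr ⟨h, measure_ne_top P A⟩)

/-- A set integral over `S ∩ U ⁻¹' V` is nonnegative if it is so on each fibre of `U` over `V`. -/
theorem setIntegral_inter_preimage_nonneg {Ω 𝒰 : Type*} [MeasurableSpace Ω] {P : Measure Ω}
    [Countable 𝒰] [MeasurableSpace 𝒰] [MeasurableSingletonClass 𝒰]
    {U : Ω → 𝒰} (hU : Measurable U) {f : Ω → ℝ} (hf : Integrable f P)
    {S : Set Ω} (hS : MeasurableSet S) (V : Set 𝒰)
    (h : ∀ u ∈ V, 0 ≤ ∫ ω in S ∩ U ⁻¹' {u}, f ω ∂P) :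
    0 ≤ ∫ ω in S ∩ U ⁻¹' V, f ω ∂P := by
  have hV : S ∩ U ⁻¹' V = ⋃ u : V, S ∩ U ⁻¹' {(u : 𝒰)} := by
    ext ω
    simp
  rw [hV, integral_iUnion (fun u => hS.inter (hU (measurableSet_singleton _))) ?_
    hf.integrableOn]
  · exact tsum_nonneg fun u => h u u.2
  · intro u v huv
    refine Set.disjoint_left.mpr fun ω hu hv => huv (Subtype.ext ?_)
    exact hu.2.symm.trans hv.2

/-- Removing from an event a part on which the average is at most `t` does not decrease the
average, provided the remaining average is at least `t`. -/
theorem condE_union_le {Ω : Type*} [MeasurableSpace Ω] {P : Measure Ω} [IsFiniteMeasure P]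
    {Z : Ω → ℝ} (hZ : Integrable Z P) {B D : Set Ω} (hD : MeasurableSet D)
    (hBD : Disjoint B D) (hB : 0 < P B) {t : ℝ}
    (hBt : 0 ≤ ∫ ω in B, (Z ω - t) ∂P) (hDt : 0 ≤ ∫ ω in D, (t - Z ω) ∂P) :
    condE P Z (B ∪ D) ≤ condE P Z B := by
  have hBpos : 0 < P.real B := ENNReal.toReal_pos hB.ne' (measure_ne_top P B)
  have hDnn : 0 ≤ P.real D := measureReal_nonneg
  rw [integral_sub hZ.integrableOn (integrable_const t), setIntegral_const, smul_eq_mul] at hBt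
  rw [integral_sub (integrable_const t) hZ.integrableOn, setIntegral_const, smul_eq_mul] at hDt
  unfold condE
  change _ / P.real (B ∪ D) ≤ _ / P.real B
  rw [measureReal_union hBD hD, setIntegral_union hBD hD hZ.integrableOn hZ.integrableOn,
    div_le_div_iff₀ (by positivity) hBpos]
  nlinarith [mul_nonneg hBt hDnn, mul_nonneg hDt hBpos.le]

/-- **Corollary 3, pointwise part.** With the modified selection rule
`S̃_τ̃ := 1(μ(X, R, U) ≥ c + τ̃·R)` (discrimination yields fewer labels for group
`R = 1`), the predictor `E[Y | X = x, R = 1, S̃_τ̃ = 1]` is weakly increasing in `τ̃`,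
while the predictor for the group `R = 0` does not depend on `τ̃`. -/
theorem fewer_labels_pointwise
    {Ω : Type*} [MeasurableSpace Ω] (P : Measure Ω) [IsProbabilityMeasure P]
    {𝒳 𝒰 : Type*} [Countable 𝒳] [Countable 𝒰]
    [MeasurableSpace 𝒳] [MeasurableSingletonClass 𝒳]
    [MeasurableSpace 𝒰] [MeasurableSingletonClass 𝒰]
    (X : Ω → 𝒳) (U : Ω → 𝒰) (R Y : Ω → ℝ)
    (hX : Measurable X) (hU : Measurable U) (hR : Measurable R) (hY : Measurable Y)
    (hR01 : ∀ ω, R ω = 0 ∨ R ω = 1) (hY01 : ∀ ω, Y ω = 0 ∨ Y ω = 1)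
    -- every point of the essential range of (X, R, U) has positive mass
    (hXRU : ∀ ω, 0 < P {ω' | X ω' = X ω ∧ R ω' = R ω ∧ U ω' = U ω})
    (c : ℝ) (hc : 0 < c)
    -- μ(x, r, u) = E[Y | X = x, R = r, U = u]
    (μ : 𝒳 → ℝ → 𝒰 → ℝ)
    (hμ : ∀ x r u, μ x r u = condE P Y {ω | X ω = x ∧ R ω = r ∧ U ω = u})
    -- the modified selection indicator S̃_τ̃ = 1(μ(X, R, U) ≥ c + τ̃·R)
    (St : ℝ → Ω → ℝ)
    (hSt : ∀ τ ω, St τ ω = if c + τ * R ω ≤ μ (X ω) (R ω) (U ω) then 1 else 0)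
    (x : 𝒳) (τt₁ τt₂ : ℝ) (hτt₁ : 0 ≤ τt₁) (hτt₂ : 0 ≤ τt₂) :
    (τt₁ ≤ τt₂ → 0 < P {ω | X ω = x ∧ R ω = 1 ∧ St τt₂ ω = 1} →
      condE P Y {ω | X ω = x ∧ R ω = 1 ∧ St τt₁ ω = 1} ≤
        condE P Y {ω | X ω = x ∧ R ω = 1 ∧ St τt₂ ω = 1}) ∧
    (0 < P {ω | X ω = x ∧ R ω = 0 ∧ St τt₁ ω = 1} →
      condE P Y {ω | X ω = x ∧ R ω = 0 ∧ St τt₁ ω = 1} =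
        condE P Y {ω | X ω = x ∧ R ω = 0 ∧ St τt₂ ω = 1}) := by
  have hYint : Integrable Y P := by
    refine Integrable.of_bound hY.aestronglyMeasurable 1 (Filter.Eventually.of_forall fun ω => ?_)
    rcases hY01 ω with h | h <;> simp [h]
  have hSt_iff : ∀ τ ω, St τ ω = 1 ↔ c + τ * R ω ≤ μ (X ω) (R ω) (U ω) := by
    intro τ ω
    rw [hSt]
    split_ifs with h <;> simp [h]
  refine ⟨fun hτ hpos => ?_, fun _ => ?_⟩
  · set S : Set Ω := {ω | X ω = x ∧ R ω = 1} with hSdef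
    have hS : MeasurableSet S :=
      (hX (measurableSet_singleton x)).inter (hR (measurableSet_singleton 1))
    have hsel : ∀ τ, {ω | X ω = x ∧ R ω = 1 ∧ St τ ω = 1} =
        S ∩ U ⁻¹' {u | c + τ ≤ μ x 1 u} := by
      intro τ
      ext ω
      simp only [hSt_iff, hSdef, Set.mem_ofPred_eq, Set.mem_inter_iff, Set.mem_preimage, and_assoc]
      refine and_congr_right fun h₁ => and_congr_right fun h₂ => ?_
      rw [h₁, h₂, mul_one]
    have hfib : ∀ u, ∫ ω in S ∩ U ⁻¹' {u}, Y ω ∂P = μ x 1 u * P.real (S ∩ U ⁻¹' {u}) := by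
      intro u
      have hset : {ω | X ω = x ∧ R ω = 1 ∧ U ω = u} = S ∩ U ⁻¹' {u} := by
        ext ω
        simp [hSdef, and_assoc]
      rw [hμ, hset]
      exact (condE_mul_toReal P Y _).symm
    have hunion : S ∩ U ⁻¹' {u | c + τt₁ ≤ μ x 1 u} =
        S ∩ U ⁻¹' {u | c + τt₂ ≤ μ x 1 u} ∪
          S ∩ U ⁻¹' {u | c + τt₁ ≤ μ x 1 u ∧ μ x 1 u < c + τt₂} := by
      ext ω
      simp only [Set.mem_inter_iff, Set.mem_union, Set.mem_preimage, Set.mem_ofPred_eq]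
      grind
    rw [hsel] at hpos
    rw [hsel, hsel, hunion]
    refine condE_union_le (t := c + τt₂) hYint
      (hS.inter (hU (Set.to_countable _).measurableSet)) ?_ hpos ?_ ?_
    · exact Set.disjoint_left.mpr fun ω h₁ h₂ => not_lt_of_ge h₁.2 h₂.2.2
    · refine setIntegral_inter_preimage_nonneg (f := fun ω => Y ω - (c + τt₂)) hU
        (hYint.sub (integrable_const _)) hS _ ?_
      intro u hu
      rw [integral_sub hYint.integrableOn (integrable_const _), setIntegral_const, smul_eq_mul,
        hfib]
      nlinarith [mul_nonneg (sub_nonneg.mpr hu) (measureReal_nonneg (μ := P)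
        (s := S ∩ U ⁻¹' {u}))]
    · refine setIntegral_inter_preimage_nonneg (f := fun ω => c + τt₂ - Y ω) hU
        ((integrable_const _).sub hYint) hS _ ?_
      intro u hu
      rw [integral_sub (integrable_const _) hYint.integrableOn, setIntegral_const, smul_eq_mul,
        hfib]
      nlinarith [mul_nonneg (sub_nonneg.mpr hu.2.le) (measureReal_nonneg (μ := P)
        (s := S ∩ U ⁻¹' {u}))]
  · congr 1
    ext ω
    simp only [hSt_iff, Set.mem_ofPred_eq]
    refine and_congr_right fun _ => and_congr_right fun h => ?_
    simp [h]
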